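/- arXiv:2302.13060 — 4 statements merged into one kernel-verified Lean document; each statement's English description precedes it below -/
import Mathlib

section
/- Let n ≥ 2 be an integer, X an n-Urysohn topological space, and κ, λ infinite cardinals. If X has a dense subset D with |D| ≤ λ, n-ψ_c(X) ≤ κ, and wt(X) ≤ κ, then |X| ≤ λ^κ. -/
open Set Cardinal

universe u

/-- `X` is `n`-Urysohn: any `n` pairwise distinct points admit open
neighbourhoods whose closures have empty intersection. -/
def NUrysohn (X : Type u) [TopologicalSpace X] (n : ℕ) : Prop :=
  ∀ x : Fin n → X, Function.Injective x →
    ∃ U : Fin n → Set X, (∀ i, IsOpen (U i) ∧ x i ∈ U i) ∧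
      (⋂ i, closure (U i)) = ∅

/-- `n-ψ_c(X) ≤ κ`. -/
def NPsiCLe (X : Type u) [TopologicalSpace X] (n : ℕ) (κ : Cardinal.{u}) : Prop :=
  ∃ V : X → Set (Set X),
    (∀ x : X, #(V x) ≤ κ ∧ ∀ U ∈ V x, IsOpen U ∧ x ∈ U) ∧
    ∀ x : Fin n → X, Function.Injective x →
      (⋂ i, ⋂ U ∈ V (x i), closure U) = ∅

/-- The tightness of `Y` is at most `κ`. -/
def TightnessLe (Y : Type u) [TopologicalSpace Y] (κ : Cardinal.{u}) : Prop :=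
  ∀ (y : Y) (A : Set Y), y ∈ closure A → ∃ B ⊆ A, #B ≤ κ ∧ y ∈ closure B

/-- The weak tightness `wt(X)` of `X` is at most `κ`: there is a cover `𝒞` of
`X` with `|𝒞| ≤ 2^κ` such that every `C ∈ 𝒞` has subspace tightness `≤ κ` and
`X = ⋃ {cl B : B ⊆ C, |B| ≤ 2^κ}`. -/
def WeakTightnessLe (X : Type u) [TopologicalSpace X] (κ : Cardinal.{u}) : Prop :=
  ∃ 𝒞 : Set (Set X), ⋃₀ 𝒞 = Set.univ ∧ #𝒞 ≤ 2 ^ κ ∧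
    ∀ C ∈ 𝒞, TightnessLe (↥C) κ ∧
      (⋃ B ∈ {B : Set X | B ⊆ C ∧ #B ≤ 2 ^ κ}, closure B) = Set.univ

/-- A set of cardinality at most `μ` is contained in a set of cardinality at most `μ` that is
closed under a set-valued map whose values have cardinality at most `μ`. -/
theorem exists_superset_mk_le_closed {X : Type u} {μ : Cardinal.{u}} (hμ : ℵ₀ ≤ μ)
    (F : X → Set X) (hF : ∀ x, #(F x) ≤ μ) (D : Set X) (hD : #D ≤ μ) :
    ∃ E : Set X, D ⊆ E ∧ #E ≤ μ ∧ ∀ x ∈ E, F x ⊆ E := by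
  obtain ⟨S, hS₀, hS₁⟩ : ∃ S : ℕ → Set X, S 0 = D ∧ ∀ k, S (k + 1) = S k ∪ ⋃ x ∈ S k, F x :=
    ⟨Nat.rec D fun _ T => T ∪ ⋃ x ∈ T, F x, rfl, fun _ => rfl⟩
  have hS : ∀ k : ℕ, #(S k) ≤ μ := by
    intro k
    induction k with
    | zero => rwa [hS₀]
    | succ k ih =>
      rw [hS₁]
      refine (mk_union_le _ _).trans (add_le_of_le hμ ih ?_)
      exact (mk_biUnion_le F (S k)).trans (mul_le_of_le hμ ih (ciSup_le' fun x => hF x))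
  refine ⟨⋃ k, S k, hS₀ ▸ subset_iUnion S 0, ?_, ?_⟩
  · have h := mk_iUnion_le_lift.{u, 0} S
    simp only [lift_uzero, mk_nat, lift_aleph0] at h
    exact h.trans (mul_le_of_le hμ hμ (ciSup_le' hS))
  · intro x hx
    obtain ⟨k, hk⟩ := mem_iUnion.1 hx
    exact (subset_biUnion_of_mem (u := F) hk).trans
      (subset_union_right.trans ((hS₁ k).ge.trans (subset_iUnion S (k + 1))))

/-- If the weak tightness is at most `κ`, a set of cardinality at most `μ ≥ 2 ^ κ` can be enlarged
to a set `E` of cardinality at most `μ` such that every point of `closure E` is in the closure of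
a subset of `E` of cardinality at most `κ`. -/
theorem WeakTightnessLe.exists_superset {X : Type u} [TopologicalSpace X] {κ μ : Cardinal.{u}}
    (hwt : WeakTightnessLe X κ) (hμ : ℵ₀ ≤ μ) (hκμ : 2 ^ κ ≤ μ) (D : Set X) (hD : #D ≤ μ) :
    ∃ E : Set X, D ⊆ E ∧ #E ≤ μ ∧
      ∀ x ∈ closure E, ∃ A ⊆ E, #A ≤ κ ∧ x ∈ closure A := by
  obtain ⟨𝒞, hcover, hcard, h𝒞⟩ := hwt
  have hex : ∀ (x : X) (C : 𝒞), ∃ B ⊆ (C : Set X), #B ≤ 2 ^ κ ∧ x ∈ closure B := by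
    intro x C
    have hx : x ∈ ⋃ B ∈ {B : Set X | B ⊆ C ∧ #B ≤ 2 ^ κ}, closure B := by
      rw [(h𝒞 C C.2).2]
      trivial
    obtain ⟨B, hB, hxB⟩ := mem_iUnion₂.1 hx
    exact ⟨B, hB.1, hB.2, hxB⟩
  choose B hBC hBcard hBx using hex
  obtain ⟨E, hDE, hE, hBE⟩ := exists_superset_mk_le_closed hμ (fun x => ⋃ C, B x C)
    (fun x => (mk_iUnion_le _).trans (mul_le_of_le hμ (hcard.trans hκμ)
      (ciSup_le' fun C => (hBcard x C).trans hκμ))) D hD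
  refine ⟨E, hDE, hE, fun x hx => ?_⟩
  obtain ⟨C, hC, hxC⟩ := mem_sUnion.1 (hcover ▸ mem_univ x)
  have hsat : E ⊆ closure (C ∩ E) := fun y hy =>
    closure_mono (subset_inter (hBC y ⟨C, hC⟩)
      ((subset_iUnion (B y) ⟨C, hC⟩).trans (hBE y hy))) (hBx y ⟨C, hC⟩)
  have hx' : x ∈ closure (C ∩ E) := closure_minimal hsat isClosed_closure hx
  obtain ⟨A, hAE, hA, hxA⟩ := (h𝒞 C hC).1 ⟨x, hxC⟩ ((↑) ⁻¹' E)
    (closure_subtype.2 (by rwa [Subtype.image_preimage_coe]))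
  exact ⟨(↑) '' A, image_subset_iff.2 hAE, mk_image_le.trans hA, closure_subtype.1 hxA⟩

/-- A map with no `n` distinct points in a common fibre has a domain of cardinality at most that
of any infinite bound on its codomain. -/
theorem mk_le_of_forall_not_injective {α β : Type u} {μ : Cardinal.{u}} (hμ : ℵ₀ ≤ μ)
    (hβ : #β ≤ μ) (f : α → β) (n : ℕ)
    (h : ∀ b (x : Fin n → α), (∀ i, f (x i) = b) → ¬ Function.Injective x) : #α ≤ μ := by
  refine (mk_le_mk_mul_of_mk_preimage_le f (c := ℵ₀) fun b => ?_).trans (mul_le_of_le hμ hβ hμ)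
  by_contra hb
  have : Infinite (f ⁻¹' {b}) := infinite_iff.2 (not_le.1 hb).le
  have e := (Fin.valEmbedding (n := n)).trans (Infinite.natEmbedding (f ⁻¹' {b}))
  exact h b (fun i => e i) (fun i => (e i).2) (Subtype.val_injective.comp e.injective)

/-- an `n`-Urysohn space `X` with a dense set of cardinality
`≤ λ`, `n-ψ_c(X) ≤ κ` and `wt(X) ≤ κ` satisfies `|X| ≤ λ^κ`. -/
theorem card_le_density_pow_nPsiC_wt (n : ℕ) (hn : 2 ≤ n)
    (X : Type u) [TopologicalSpace X] (hX : NUrysohn X n)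
    (κ lam : Cardinal.{u}) (hκ : ℵ₀ ≤ κ) (hlam : ℵ₀ ≤ lam)
    (D : Set X) (hD : Dense D) (hDcard : #D ≤ lam)
    (hpsi : NPsiCLe X n κ) (hwt : WeakTightnessLe X κ) :
    #X ≤ lam ^ κ := by
  classical
  have hμ : ℵ₀ ≤ lam ^ κ :=
    hlam.trans (self_le_power lam (one_le_aleph0.trans hκ))
  have hμκ : (lam ^ κ) ^ κ = lam ^ κ := by
    rw [← power_mul, mul_eq_self hκ]
  obtain ⟨E, hDE, hE, htight⟩ := hwt.exists_superset hμ
    (power_le_power_right (ofNat_lt_aleph0.le.trans hlam)) D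
    (hDcard.trans (self_le_power lam (one_le_aleph0.trans hκ)))
  have hdense := hD.mono hDE
  choose A hAE hA hxA using fun x => htight x (hdense x)
  obtain ⟨V, hV, hVn⟩ := hpsi
  have bound : ∀ {Y : Type u} (S : Set Y), #S ≤ lam ^ κ →
      #{t : Set Y // t ⊆ S ∧ #t ≤ κ} ≤ lam ^ κ := fun S hS =>
    (mk_bounded_subset_le S κ).trans
      ((power_le_power_right (max_le hS hμ)).trans hμκ.le)
  let P : Set (Set X) := {t | t ⊆ E ∧ #t ≤ κ}
  let f : X → {t : Set (Set X) // t ⊆ P ∧ #t ≤ κ} := fun x =>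
    ⟨(fun U => U ∩ A x) '' V x,
      image_subset_iff.2 fun U _ => ⟨inter_subset_right.trans (hAE x),
        (mk_le_mk_of_subset inter_subset_right).trans (hA x)⟩,
      mk_image_le.trans (hV x).1⟩
  refine mk_le_of_forall_not_injective hμ (bound P (bound E hE)) f n fun b x hx hinj => ?_
  let i₀ : Fin n := ⟨0, by omega⟩
  refine (hVn x hinj ▸ notMem_empty (x i₀)) (mem_iInter.2 fun i => mem_iInter₂.2 fun U hU => ?_)
  have hmem : U ∩ A (x i) ∈ (f (x i₀)).1 := by
    rw [hx i₀, ← hx i]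
    exact mem_image_of_mem _ hU
  obtain ⟨W, hW, hWU⟩ := hmem
  have hxW : x i₀ ∈ closure (W ∩ A (x i₀)) :=
    ((hV (x i₀)).2 W hW).1.inter_closure ⟨((hV (x i₀)).2 W hW).2, hxA (x i₀)⟩
  exact closure_mono (hWU.le.trans inter_subset_left) hxW
end

section
/- Let n ≥ 2 be an integer, X an n-Urysohn quasiregular topological space, and κ, λ infinite cardinals. If πχ(X) ≤ λ, c(X) ≤ κ, wt(X) ≤ κ, and n-ψ_c(X) ≤ κ, then |X| ≤ λ^κ. -/
open Set Cardinal

universe u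

/-- `X` is quasiregular: every nonempty open set contains a nonempty open set
together with its closure. -/
def Quasiregular (X : Type u) [TopologicalSpace X] : Prop :=
  ∀ U : Set X, IsOpen U → U.Nonempty →
    ∃ V : Set X, IsOpen V ∧ V.Nonempty ∧ closure V ⊆ U

/-- The π-character of `X` is at most `κ`. -/
def PiCharLe (X : Type u) [TopologicalSpace X] (κ : Cardinal.{u}) : Prop :=
  ∀ x : X, ∃ 𝒰 : Set (Set X), #𝒰 ≤ κ ∧ (∀ U ∈ 𝒰, IsOpen U ∧ U.Nonempty) ∧
    ∀ W : Set X, IsOpen W → x ∈ W → ∃ U ∈ 𝒰, U ⊆ W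

/-- The cellularity of `X` is at most `κ`. -/
def CellularityLe (X : Type u) [TopologicalSpace X] (κ : Cardinal.{u}) : Prop :=
  ∀ 𝒰 : Set (Set X), (∀ U ∈ 𝒰, IsOpen U ∧ U.Nonempty) →
    𝒰.PairwiseDisjoint id → #𝒰 ≤ κ

/-- An enumeration, by an index type of cardinality at least that of the set, of a nonempty set. -/
theorem exists_range_eq_of_mk_le {α K : Type u} {s : Set α} (hs : s.Nonempty) (h : #s ≤ #K) :
    ∃ f : K → α, range f = s := by
  have : Nonempty s := hs.to_subtype
  obtain ⟨e⟩ := h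
  refine ⟨fun k => (Function.invFun e k : s), ?_⟩
  have := (Function.invFun_surjective e.injective)
  rw [show (fun k => ((Function.invFun e k : s) : α)) = Subtype.val ∘ Function.invFun e from rfl,
    range_comp, this.range_eq, image_univ, Subtype.range_coe]

/-- In a space of cellularity at most `#K`, a nonempty family of open sets has a `K`-indexed
subfamily whose union is dense in the union of the family. -/
theorem CellularityLe.exists_iUnion_subset_closure {X K : Type u} [TopologicalSpace X]
    (hc : CellularityLe X #K) [Nonempty K] {ι : Type u} [Nonempty ι] (s : ι → Set X)
    (hs : ∀ i, IsOpen (s i)) :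
    ∃ g : K → ι, ⋃ i, s i ⊆ closure (⋃ k, s (g k)) := by
  obtain ⟨M, hM⟩ : ∃ M, Maximal (fun M : Set (Set X) =>
      (∀ U ∈ M, (IsOpen U ∧ U.Nonempty) ∧ ∃ i, U ⊆ s i) ∧ M.PairwiseDisjoint id) M := by
    refine zorn_subset {M : Set (Set X) |
      (∀ U ∈ M, (IsOpen U ∧ U.Nonempty) ∧ ∃ i, U ⊆ s i) ∧ M.PairwiseDisjoint id} ?_
    intro c hcS hchain
    refine ⟨⋃₀ c, ⟨?_, ?_⟩, fun t ht => subset_sUnion_of_mem ht⟩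
    · rintro U ⟨t, ht, hU⟩
      exact (hcS ht).1 U hU
    · exact (pairwiseDisjoint_sUnion hchain.directedOn).2 fun t ht => (hcS ht).2
  have hcard : #M ≤ #K := hc M (fun U hU => (hM.prop.1 U hU).1) hM.prop.2
  choose! i hi using fun U hU => (hM.prop.1 U hU).2
  obtain ⟨g, hg⟩ : ∃ g : K → ι, ∀ U ∈ M, ∃ k, g k = i U := by
    obtain hne | hne := M.eq_empty_or_nonempty
    · exact ⟨fun _ => Classical.arbitrary ι, by simp [hne]⟩
    · obtain ⟨f, hf⟩ := exists_range_eq_of_mk_le hne hcard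
      refine ⟨fun k => i (f k), fun U hU => ?_⟩
      rw [← hf] at hU
      obtain ⟨k, rfl⟩ := hU
      exact ⟨k, rfl⟩
  refine ⟨g, iUnion_subset fun j y hy => ?_⟩
  by_contra hycl
  set O : Set X := s j \ closure (⋃ k, s (g k)) with hO
  have hOne : O.Nonempty := ⟨y, hy, hycl⟩
  have hdisj : ∀ U ∈ M, Disjoint O U := by
    intro U hU
    obtain ⟨k, hk⟩ := hg U hU
    refine disjoint_left.2 fun z hz hzU => hz.2 (subset_closure (mem_iUnion.2 ⟨k, ?_⟩))
    rw [hk]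
    exact hi U hU hzU
  have hins : insert O M ⊆ M := by
    refine hM.le_of_ge ⟨?_, ?_⟩ (subset_insert _ _)
    · rintro U (rfl | hU)
      · exact ⟨⟨(hs j).sdiff isClosed_closure, hOne⟩, j, sdiff_subset⟩
      · exact hM.prop.1 U hU
    · exact hM.prop.2.insert fun U hU _ => hdisj U hU
  have := hdisj O (hins (mem_insert _ _))
  exact hOne.ne_empty (disjoint_self.1 this)

/-- Any operation of arity `K` on `X` with parameters in `K → L` has a nonempty closed subset of
cardinality at most `#L ^ #K`. -/
theorem exists_closed_under_mk_le {X K L : Type u} [Nonempty X] (hK : ℵ₀ ≤ #K) (hL : ℵ₀ ≤ #L)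
    (f : (K → X × L) → X) :
    ∃ D : Set X, D.Nonempty ∧ #D ≤ #L ^ #K ∧
      ∀ g : K → X × L, (∀ k, (g k).1 ∈ D) → f g ∈ D := by
  let β : Option (K → L) → Type u := fun a => a.elim PEmpty fun _ => K
  let value : WType β → X := WType.elim X fun p => match p with
    | ⟨none, _⟩ => Classical.arbitrary X
    | ⟨some a, t⟩ => f fun k => (t k, a k)
  have hμ : ℵ₀ ≤ #L ^ #K := hL.trans (self_le_power _ (one_le_aleph0.trans hK))
  have hpow : (#L ^ #K) ^ #K = #L ^ #K := by rw [← power_mul, mul_eq_self hK]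
  refine ⟨range value, ⟨value ⟨none, PEmpty.elim⟩, mem_range_self _⟩, mk_range_le.trans ?_, ?_⟩
  · refine WType.cardinalMk_le_of_le ?_
    have hterm : ∀ a, (#L ^ #K) ^ #(β a) ≤ #L ^ #K
      | none => by simpa [β] using one_le_aleph0.trans hμ
      | some _ => hpow.le
    calc Cardinal.sum (fun a => (#L ^ #K) ^ #(β a))
        ≤ Cardinal.sum fun _ : Option (K → L) => #L ^ #K := sum_le_sum _ _ hterm
      _ = (#L ^ #K + 1) * #L ^ #K := by rw [sum_const', mk_option, ← power_def]
      _ = #L ^ #K := by rw [add_one_eq hμ, mul_eq_self hμ]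
  · intro g hg
    choose t ht using hg
    refine ⟨⟨some fun k => (g k).2, t⟩, ?_⟩
    change f (fun k => (value (t k), (g k).2)) = f g
    simp only [ht]

/-- A quasiregular space with a family `p x` of at most `#L` open sets forming a local π-base at
each `x` and cellularity at most `#K` has a dense set of cardinality at most `#L ^ #K`. -/
theorem Quasiregular.exists_dense_mk_le {X K L : Type u} [TopologicalSpace X] [Nonempty X]
    (hq : Quasiregular X) (hK : ℵ₀ ≤ #K) (hL : ℵ₀ ≤ #L) (hc : CellularityLe X #K)
    (p : X → L → Set X) (hpo : ∀ x j, IsOpen (p x j)) (hpn : ∀ x j, (p x j).Nonempty)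
    (hp : ∀ x W, IsOpen W → x ∈ W → ∃ j, p x j ⊆ W) :
    ∃ D : Set X, Dense D ∧ #D ≤ #L ^ #K := by
  classical
  have : Nonempty K := mk_ne_zero_iff.1 (aleph0_pos.trans_le hK).ne'
  let u : (K → X × L) → Set X := fun g => ⋃ k, p (g k).1 (g k).2
  obtain ⟨f, hf⟩ : ∃ f : (K → X × L) → X, ∀ g, (closure (u g))ᶜ.Nonempty → f g ∉ closure (u g) := by
    choose! f hf using fun (g : K → X × L) (h : (closure (u g))ᶜ.Nonempty) => h
    exact ⟨f, hf⟩
  obtain ⟨D, hDne, hDcard, hD⟩ := exists_closed_under_mk_le hK hL f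
  refine ⟨D, ?_, hDcard⟩
  by_contra hnd
  obtain ⟨V, hVo, hVne, hV⟩ := hq (closure D)ᶜ isClosed_closure.isOpen_compl
    (nonempty_compl.2 fun h => hnd (dense_iff_closure_eq.2 h))
  have hDV : ∀ d ∈ D, d ∈ (closure V)ᶜ := fun d hd h => hV h (subset_closure hd)
  let ι := {a : X × L // a.1 ∈ D ∧ p a.1 a.2 ⊆ (closure V)ᶜ}
  have hι : Nonempty ι := by
    obtain ⟨d, hd⟩ := hDne
    obtain ⟨j, hj⟩ := hp d _ isClosed_closure.isOpen_compl (hDV d hd)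
    exact ⟨⟨(d, j), hd, hj⟩⟩
  obtain ⟨g, hg⟩ := hc.exists_iUnion_subset_closure (K := K) (fun a : ι => p a.1.1 a.1.2)
    fun a => hpo _ _
  have hgV : Disjoint V (u fun k => (g k).1) := by
    refine disjoint_left.2 fun z hz hzu => ?_
    obtain ⟨k, hk⟩ := mem_iUnion.1 hzu
    exact (g k).2.2 hk (subset_closure hz)
  have hfD := hD (fun k => (g k).1) fun k => (g k).2.1
  refine hf (fun k => (g k).1) ?_ ?_
  · obtain ⟨v, hv⟩ := hVne
    exact ⟨v, fun h => disjoint_left.1 (hgV.closure_right hVo) hv h⟩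
  · refine closure_minimal hg isClosed_closure (mem_closure_iff.2 fun W hW hxW => ?_)
    obtain ⟨j, hj⟩ := hp _ _ (hW.inter isClosed_closure.isOpen_compl) ⟨hxW, hDV _ hfD⟩
    obtain ⟨z, hz⟩ := hpn (f fun k => (g k).1) j
    exact ⟨z, (hj hz).1, mem_iUnion.2 ⟨⟨(_, j), hfD, fun z hz => (hj hz).2⟩, hz⟩⟩

/-- A quasiregular space with π-character at most `lam` and cellularity at most `κ` has at most
`lam ^ κ` closures of nonempty open sets. -/
theorem Quasiregular.mk_closure_isOpen_le {X : Type u} [TopologicalSpace X]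
    (hq : Quasiregular X) {κ lam : Cardinal.{u}} (hκ : ℵ₀ ≤ κ) (hlam : ℵ₀ ≤ lam)
    (hpi : PiCharLe X lam) (hc : CellularityLe X κ) :
    #{F : Set X | ∃ O, IsOpen O ∧ O.Nonempty ∧ closure O = F} ≤ lam ^ κ := by
  obtain _ | _ := isEmpty_or_nonempty X
  · have : {F : Set X | ∃ O, IsOpen O ∧ O.Nonempty ∧ closure O = F} = ∅ :=
      eq_empty_of_forall_notMem fun F ⟨O, _, ⟨x, _⟩, _⟩ => isEmptyElim x
    rw [this, mk_eq_zero]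
    exact zero_le
  induction κ using Cardinal.inductionOn with | _ K => ?_
  induction lam using Cardinal.inductionOn with | _ L => ?_
  have : Nonempty K := mk_ne_zero_iff.1 (aleph0_pos.trans_le hκ).ne'
  have hbase : ∀ x : X, ∃ p : L → Set X, (∀ j, IsOpen (p j) ∧ (p j).Nonempty) ∧
      ∀ W, IsOpen W → x ∈ W → ∃ j, p j ⊆ W := by
    intro x
    obtain ⟨𝒰, hcard, ho, hW⟩ := hpi x
    obtain ⟨U, hU, -⟩ := hW univ isOpen_univ (mem_univ x)
    obtain ⟨p, rfl⟩ := exists_range_eq_of_mk_le ⟨U, hU⟩ hcard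
    exact ⟨p, fun j => ho _ (mem_range_self j), fun W hWo hx => by simpa using hW W hWo hx⟩
  choose p hp hpW using hbase
  obtain ⟨D, hD, hDcard⟩ := hq.exists_dense_mk_le hκ hlam hc p (fun x j => (hp x j).1)
    (fun x j => (hp x j).2) hpW
  let h : (K → D × L) → Set X := fun g => closure (⋃ k, p (g k).1 (g k).2)
  have hsub : {F : Set X | ∃ O, IsOpen O ∧ O.Nonempty ∧ closure O = F} ⊆ range h := by
    rintro _ ⟨O, hO, hOne, rfl⟩
    let ι := {a : D × L // p a.1 a.2 ⊆ O}
    have hι : Nonempty ι := by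
      obtain ⟨d, hdO, hd⟩ := hD.inter_open_nonempty O hO hOne
      obtain ⟨j, hj⟩ := hpW d O hO hdO
      exact ⟨⟨(⟨d, hd⟩, j), hj⟩⟩
    obtain ⟨g, hg⟩ := hc.exists_iUnion_subset_closure (K := K) (fun a : ι => p a.1.1 a.1.2)
      fun a => (hp _ _).1
    refine ⟨fun k => (g k).1, subset_antisymm
      (closure_mono (iUnion_subset fun k => (g k).2)) (closure_minimal (fun y hy => ?_)
        isClosed_closure)⟩
    refine closure_minimal hg isClosed_closure (mem_closure_iff.2 fun W hW hyW => ?_)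
    obtain ⟨d, hdO, hd⟩ := hD.inter_open_nonempty (W ∩ O) (hW.inter hO) ⟨y, hyW, hy⟩
    obtain ⟨j, hj⟩ := hpW d _ (hW.inter hO) hdO
    obtain ⟨z, hz⟩ := (hp d j).2
    exact ⟨z, (hj hz).1, mem_iUnion.2 ⟨⟨(⟨d, hd⟩, j), fun z hz => (hj hz).2⟩, hz⟩⟩
  calc #{F : Set X | ∃ O, IsOpen O ∧ O.Nonempty ∧ closure O = F}
      ≤ #(range h) := mk_le_mk_of_subset hsub
    _ ≤ #(K → D × L) := mk_range_le
    _ = (#D * #L) ^ #K := by simp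
    _ ≤ (#L ^ #K * #L ^ #K) ^ #K := by
        refine power_le_power_right (mul_le_mul' hDcard ?_)
        exact self_le_power _ (one_le_aleph0.trans hκ)
    _ = #L ^ #K := by
        rw [← power_add, add_eq_self hκ, ← power_mul, mul_eq_self hκ]

/-- an `n`-Urysohn quasiregular space `X` with `πχ(X) ≤ λ`,
`c(X) ≤ κ`, `wt(X) ≤ κ` and `n-ψ_c(X) ≤ κ` satisfies `|X| ≤ λ^κ`. -/
theorem card_le_piChar_pow_cell_wt_nPsiC (n : ℕ) (hn : 2 ≤ n)
    (X : Type u) [TopologicalSpace X] (hX : NUrysohn X n) (hq : Quasiregular X)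
    (κ lam : Cardinal.{u}) (hκ : ℵ₀ ≤ κ) (hlam : ℵ₀ ≤ lam)
    (hpi : PiCharLe X lam) (hc : CellularityLe X κ)
    (hwt : WeakTightnessLe X κ) (hpsi : NPsiCLe X n κ) :
    #X ≤ lam ^ κ := by
  have hμ : ℵ₀ ≤ lam ^ κ := hlam.trans (self_le_power _ (one_le_aleph0.trans hκ))
  have hRO := hq.mk_closure_isOpen_le hκ hlam hpi hc
  obtain ⟨V, hV, hVn⟩ := hpsi
  induction κ using Cardinal.inductionOn with | _ K => ?_
  have henum : ∀ x : X, ∃ v : K → {F : Set X | ∃ O, IsOpen O ∧ O.Nonempty ∧ closure O = F},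
      (∀ k, x ∈ (v k : Set X)) ∧ ∀ U ∈ V x, ∃ k, (v k : Set X) = closure U := by
    intro x
    have hcard : #(insert Set.univ (V x) : Set (Set X)) ≤ #K :=
      mk_insert_le.trans
        ((add_le_add_left (hV x).1 1).trans (add_one_eq hκ).le)
    obtain ⟨v, hv⟩ := exists_range_eq_of_mk_le (insert_nonempty _ _) hcard
    have hvx : ∀ k, IsOpen (v k) ∧ x ∈ v k := by
      intro k
      obtain h | h : v k ∈ insert Set.univ (V x) := hv ▸ mem_range_self k
      · simp [h]
      · exact (hV x).2 _ h
    refine ⟨fun k => ⟨closure (v k), v k, (hvx k).1, ⟨x, (hvx k).2⟩, rfl⟩,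
      fun k => subset_closure (hvx k).2, fun U hU => ?_⟩
    obtain ⟨k, rfl⟩ : U ∈ range v := hv ▸ mem_insert_of_mem _ hU
    exact ⟨k, rfl⟩
  choose φ hφ hφV using henum
  have hfib : ∀ b, #(φ ⁻¹' {b}) ≤ ℵ₀ := by
    intro b
    by_contra! hlt
    have : Infinite (φ ⁻¹' {b}) := infinite_iff.2 hlt.le
    let e := Infinite.natEmbedding (φ ⁻¹' {b})
    let x : Fin n → X := fun i => e i
    have hx : Function.Injective x := fun i j h => Fin.ext (e.injective (Subtype.ext h))
    have hxb : ∀ i, φ (x i) = b := fun i => (e i).2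
    have hmem : x ⟨0, by omega⟩ ∈ ⋂ i, ⋂ U ∈ V (x i), closure U := by
      simp only [mem_iInter]
      intro i U hU
      obtain ⟨k, hk⟩ := hφV _ U hU
      rw [← hk, hxb i, ← hxb ⟨0, by omega⟩]
      exact hφ _ k
    rw [hVn x hx] at hmem
    exact hmem
  calc #X ≤ #(K → {F : Set X | ∃ O, IsOpen O ∧ O.Nonempty ∧ closure O = F}) * ℵ₀ :=
        mk_le_mk_mul_of_mk_preimage_le φ hfib
    _ ≤ (lam ^ #K) ^ #K * lam ^ #K := by
        rw [← power_def]
        exact mul_le_mul' (power_le_power_right hRO) hμ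
    _ = lam ^ #K := by
        rw [← power_mul, mul_eq_self hκ, mul_eq_self hμ]
end

section
/- Let n ≥ 2 be an integer and f : X → Y a θ-continuous bijection between topological spaces, where Y is n-Hausdorff. If X satisfies the n-H-closed covering property, then Y satisfies the n-H-closed covering property. -/
open Set Cardinal

universe u v

/-- `X` is `n`-Hausdorff. -/
def NHausdorff (X : Type*) [TopologicalSpace X] (n : ℕ) : Prop :=
  ∀ x : Fin n → X, Function.Injective x →
    ∃ U : Fin n → Set X, (∀ i, IsOpen (U i) ∧ x i ∈ U i) ∧ (⋂ i, U i) = ∅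

/-- `f : X → Y` is θ-continuous. -/
def ThetaContinuous {X : Type u} {Y : Type v} [TopologicalSpace X]
    [TopologicalSpace Y] (f : X → Y) : Prop :=
  ∀ (x : X) (V : Set Y), IsOpen V → f x ∈ V →
    ∃ U : Set X, IsOpen U ∧ x ∈ U ∧ f '' closure U ⊆ closure V

/-- The `n`-H-closed covering property: for every `A` with `|A| ≤ n - 2` and
every family `𝒰` of open sets covering `X \ A` there is a finite `𝒱 ⊆ 𝒰`
whose closures cover `X`. -/
def NHClosedCovering (X : Type*) [TopologicalSpace X] (n : ℕ) : Prop :=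
  ∀ A : Set X, #A ≤ ((n - 2 : ℕ) : Cardinal) →
    ∀ 𝒰 : Set (Set X), (∀ U ∈ 𝒰, IsOpen U) → Set.univ \ A ⊆ ⋃₀ 𝒰 →
      ∃ 𝒱 ⊆ 𝒰, 𝒱.Finite ∧ (⋃ V ∈ 𝒱, closure V) = Set.univ

/-- if `f : X → Y` is a θ-continuous bijection, `Y` is
`n`-Hausdorff and `X` satisfies the `n`-H-closed covering property, then so
does `Y`. -/
theorem nHClosed_of_thetaContinuous_bijection (n : ℕ) (hn : 2 ≤ n)
    (X : Type u) (Y : Type v) [TopologicalSpace X] [TopologicalSpace Y]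
    (f : X → Y) (hf : Function.Bijective f) (hθ : ThetaContinuous f)
    (hY : NHausdorff Y n) (hX : NHClosedCovering X n) :
    NHClosedCovering Y n := by
  intro A hA 𝒰 hopen hcov
  have hchoice : ∀ x : X, x ∉ f ⁻¹' A →
      ∃ V ∈ 𝒰, ∃ W : Set X, IsOpen W ∧ x ∈ W ∧ f '' closure W ⊆ closure V := by
    intro x hx
    obtain ⟨V, hV, hxV⟩ := hcov ⟨mem_univ (f x), hx⟩
    exact ⟨V, hV, hθ x V (hopen V hV) hxV⟩
  have hcard : #(f ⁻¹' A : Set X) ≤ ((n - 2 : ℕ) : Cardinal) := by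
    have h := (mk_preimage_of_injective_lift f A hf.injective).trans (lift_le.2 hA)
    rwa [lift_natCast, lift_le_nat_iff] at h
  obtain ⟨𝒲, h𝒲, hfin, hunion⟩ := hX (f ⁻¹' A) hcard
    {W | IsOpen W ∧ ∃ V ∈ 𝒰, f '' closure W ⊆ closure V} (fun W hW => hW.1) (by
      rintro x ⟨-, hx⟩
      obtain ⟨V, hV, W, hW, hxW, hWV⟩ := hchoice x hx
      exact ⟨W, ⟨hW, V, hV, hWV⟩, hxW⟩)
  choose! g hg𝒰 hg using fun W (hW : W ∈ 𝒲) => (h𝒲 hW).2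
  refine ⟨g '' 𝒲, image_subset_iff.2 hg𝒰, hfin.image g, eq_univ_of_forall fun y => ?_⟩
  obtain ⟨x, rfl⟩ := hf.surjective y
  obtain ⟨W, hW, hxW⟩ := mem_iUnion₂.1 (hunion.symm ▸ mem_univ x)
  exact mem_biUnion (mem_image_of_mem g hW) (hg W hW (mem_image_of_mem f hxW))
end

section
/- Let n ≥ 2 be an integer and X an n-Hausdorff topological space satisfying the n-H-closed filter property, and let U ⊆ X be open. Then the subspace cl(U) satisfies the n-H-closed filter property: every open filter on the subspace cl(U) has adherence of cardinality ≥ n−1 (computed in the subspace cl(U)). -/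
open Set Cardinal

universe u

/-- `𝓕` is an open filter on `Z`: a nonempty family of nonempty open sets
closed under finite intersections and open supersets. -/
def IsOpenFilter (Z : Type*) [TopologicalSpace Z] (𝓕 : Set (Set Z)) : Prop :=
  𝓕.Nonempty ∧ (∀ F ∈ 𝓕, IsOpen F ∧ F.Nonempty) ∧
    (∀ F ∈ 𝓕, ∀ G ∈ 𝓕, F ∩ G ∈ 𝓕) ∧
    (∀ F ∈ 𝓕, ∀ G : Set Z, IsOpen G → F ⊆ G → G ∈ 𝓕)

/-- The `n`-H-closed filter property: every open filter has adherence of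
cardinality at least `n - 1`. -/
def NHClosedFilter (Z : Type*) [TopologicalSpace Z] (n : ℕ) : Prop :=
  ∀ 𝓕 : Set (Set Z), IsOpenFilter Z 𝓕 →
    ((n - 1 : ℕ) : Cardinal) ≤ #(⋂ F ∈ 𝓕, closure F)

/-- The trace of an open filter of `closure U` on the open set `U` generates an open filter of `X`. -/
theorem isOpenFilter_trace {X : Type*} [TopologicalSpace X] {U : Set X}
    {𝓕 : Set (Set (closure U))} (h𝓕 : IsOpenFilter (closure U) 𝓕) :
    IsOpenFilter X {V | IsOpen V ∧ ∃ F ∈ 𝓕, Subtype.val '' F ∩ U ⊆ V} := by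
  obtain ⟨⟨F₀, hF₀⟩, hopen, hinter, -⟩ := h𝓕
  refine ⟨⟨univ, isOpen_univ, F₀, hF₀, subset_univ _⟩, ?_, ?_, ?_⟩
  · rintro V ⟨hV, F, hF, hFV⟩
    refine ⟨hV, ?_⟩
    obtain ⟨hFo, x, hx⟩ := hopen F hF
    obtain ⟨W, hW, rfl⟩ := isOpen_induced_iff.mp hFo
    obtain ⟨y, hyW, hyU⟩ := mem_closure_iff.mp x.2 W hW hx
    exact ⟨y, hFV ⟨⟨⟨y, subset_closure hyU⟩, hyW, rfl⟩, hyU⟩⟩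
  · rintro V ⟨hV, F, hF, hFV⟩ V' ⟨hV', F', hF', hFV'⟩
    refine ⟨hV.inter hV', F ∩ F', hinter F hF F' hF', ?_⟩
    rintro _ ⟨⟨y, ⟨hy, hy'⟩, rfl⟩, hyU⟩
    exact ⟨hFV ⟨⟨y, hy, rfl⟩, hyU⟩, hFV' ⟨⟨y, hy', rfl⟩, hyU⟩⟩
  · rintro V ⟨-, F, hF, hFV⟩ V' hV' hVV'
    exact ⟨hV', F, hF, hFV.trans hVV'⟩

/-- The part of an open subset of `closure U` lying in the open set `U` is open in `X`. -/
theorem isOpen_image_val_inter {X : Type*} [TopologicalSpace X] {U : Set X} (hU : IsOpen U)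
    {F : Set (closure U)} (hF : IsOpen F) : IsOpen (Subtype.val '' F ∩ U) := by
  obtain ⟨W, hW, rfl⟩ := isOpen_induced_iff.mp hF
  rw [Subtype.image_preimage_coe, inter_right_comm, inter_eq_right.mpr subset_closure]
  exact hU.inter hW

/-- if `X` is `n`-Hausdorff with the `n`-H-closed filter
property and `U ⊆ X` is open, then the subspace `cl U` has the `n`-H-closed
filter property. -/
theorem closure_open_nHClosedFilter (n : ℕ) (hn : 2 ≤ n)
    (X : Type u) [TopologicalSpace X] (hX : NHausdorff X n)
    (hXf : NHClosedFilter X n) (U : Set X) (hU : IsOpen U) :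
    NHClosedFilter (↥(closure U)) n := by
  intro 𝓕 h𝓕
  refine (hXf _ (isOpenFilter_trace h𝓕)).trans ?_
  have key : ∀ x ∈ ⋂ V ∈ {V | IsOpen V ∧ ∃ F ∈ 𝓕, Subtype.val '' F ∩ U ⊆ V}, closure V,
      ∀ F ∈ 𝓕, x ∈ closure (Subtype.val '' F ∩ U) := fun x hx F hF =>
    mem_iInter₂.mp hx _ ⟨isOpen_image_val_inter hU (h𝓕.2.1 F hF).1, F, hF, Subset.rfl⟩
  obtain ⟨F₀, hF₀⟩ := h𝓕.1
  have hcl := fun x hx => closure_mono inter_subset_right (key x hx F₀ hF₀)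
  refine mk_le_of_injective (f := fun x => ⟨⟨x.1, hcl x.1 x.2⟩, ?_⟩) ?_
  · exact mem_iInter₂.mpr fun F hF => closure_subtype.mpr
      (closure_mono inter_subset_left (key x.1 x.2 F hF))
  · intro x y hxy
    exact Subtype.ext (congrArg (fun z => z.1.1) hxy)
end
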